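/- arXiv:2110.06412 — 5 statements merged into one kernel-verified Lean document; each statement's English description precedes it below -/
import Mathlib

section
/- For all m, σ > 0 and all y ∈ ℝ, the cumulative distribution function of the OSGT density satisfies: ∫_{-∞}^{y} f(t) dt = Q((m-y)/σ)/(2Q(m/σ)) if y ≤ 0, and ∫_{-∞}^{y} f(t) dt = 1 - Q((m+y)/σ)/(2Q(m/σ)) if y > 0. -/
open MeasureTheory Real Filter Set

/-- The Gaussian Q-function: `Q x = (1/√(2π)) ∫_x^∞ exp (-t²/2) dt`. -/
noncomputable def gaussQ (x : ℝ) : ℝ :=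
  (1 / Real.sqrt (2 * Real.pi)) * ∫ t in Set.Ioi x, Real.exp (-t ^ 2 / 2)

/-- The standard normal CDF: `Φ x = (1/√(2π)) ∫_{-∞}^x exp (-t²/2) dt`. -/
noncomputable def stdPhi (x : ℝ) : ℝ :=
  (1 / Real.sqrt (2 * Real.pi)) * ∫ t in Set.Iic x, Real.exp (-t ^ 2 / 2)

/-- The offset-symmetric Gaussian tails (OSGT) density with parameters `m`, `σ`,
with normalization constant `S = 2√(2πσ²) Q(m/σ)`. -/
noncomputable def osgt (m σ y : ℝ) : ℝ :=
  if y ≤ 0 then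
    Real.exp (-(y - m) ^ 2 / (2 * σ ^ 2)) /
      (2 * Real.sqrt (2 * Real.pi * σ ^ 2) * gaussQ (m / σ))
  else
    Real.exp (-(y + m) ^ 2 / (2 * σ ^ 2)) /
      (2 * Real.sqrt (2 * Real.pi * σ ^ 2) * gaussQ (m / σ))
lemma integral_comp_add_div_Ioi (g : ℝ → ℝ) (a m : ℝ) {σ : ℝ} (hσ : 0 < σ) :
    ∫ t in Set.Ioi a, g ((t + m) / σ) = σ * ∫ u in Set.Ioi ((a + m) / σ), g u := by
  have hshift : ∫ t in Set.Ioi a, g ((t + m) / σ) = ∫ t in Set.Ioi (a + m), g (t / σ) := by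
    have h := (measurePreserving_add_right volume m).setIntegral_preimage_emb
      (measurableEmbedding_addRight m) (fun t => g (t / σ)) (Set.Ioi (a + m))
    simpa using h
  rw [hshift]
  have h := integral_comp_mul_right_Ioi g (a + m) (inv_pos.2 hσ)
  simpa [div_eq_mul_inv] using h

lemma gaussQ_pos (x : ℝ) : 0 < gaussQ x := by
  have hint : Integrable fun t : ℝ => Real.exp (-t ^ 2 / 2) := by
    refine (integrable_exp_neg_mul_sq (b := 1 / 2) (by norm_num)).congr (ae_of_all _ fun t => ?_)
    ring_nf
  refine mul_pos (by positivity) ?_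
  rw [setIntegral_pos_iff_support_of_nonneg_ae (ae_of_all _ fun t => (Real.exp_pos _).le)
    hint.integrableOn]
  have hsupp : Function.support (fun t : ℝ => Real.exp (-t ^ 2 / 2)) = Set.univ :=
    Set.eq_univ_of_forall fun t => (Real.exp_pos _).ne'
  simp [hsupp]

lemma osgt_neg (m σ y : ℝ) : osgt m σ (-y) = osgt m σ y := by
  have h : (-y - m) ^ 2 = (y + m) ^ 2 := by ring
  have h' : (-y + m) ^ 2 = (y - m) ^ 2 := by ring
  rcases lt_trichotomy y 0 with hy | rfl | hy
  · simp [osgt, hy.le, hy.not_ge, h']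
  · simp
  · simp [osgt, hy.le, hy.not_ge, h]

lemma integral_Ioi_osgt (m : ℝ) {σ a : ℝ} (hσ : 0 < σ) (ha : 0 ≤ a) :
    ∫ t in Set.Ioi a, osgt m σ t = gaussQ ((m + a) / σ) / (2 * gaussQ (m / σ)) := by
  have hosgt : ∀ t ∈ Set.Ioi a, osgt m σ t = Real.exp (-((t + m) / σ) ^ 2 / 2) /
      (2 * (σ * Real.sqrt (2 * Real.pi)) * gaussQ (m / σ)) := fun t ht => by
    rw [osgt, if_neg (ha.trans_lt ht).not_ge, Real.sqrt_mul (by positivity), Real.sqrt_sq hσ.le,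
      mul_comm σ]
    congr 2
    field_simp
  rw [setIntegral_congr_fun measurableSet_Ioi hosgt, integral_div,
    integral_comp_add_div_Ioi (fun u => Real.exp (-u ^ 2 / 2)) a m hσ]
  have hQ := (gaussQ_pos (m / σ)).ne'
  have hgauss : gaussQ ((m + a) / σ) = 1 / Real.sqrt (2 * Real.pi) *
      ∫ u in Set.Ioi ((a + m) / σ), Real.exp (-u ^ 2 / 2) := by rw [gaussQ, add_comm m a]
  rw [hgauss]
  field_simp

lemma integral_Iic_osgt (m : ℝ) {σ y : ℝ} (hσ : 0 < σ) (hy : y ≤ 0) :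
    ∫ t in Set.Iic y, osgt m σ t = gaussQ ((m - y) / σ) / (2 * gaussQ (m / σ)) := by
  have h := integral_comp_neg_Iic y (osgt m σ)
  simp only [osgt_neg] at h
  rw [h, integral_Ioi_osgt m hσ (neg_nonneg.2 hy), sub_eq_add_neg]

lemma integral_Iic_zero_osgt (m : ℝ) {σ : ℝ} (hσ : 0 < σ) :
    ∫ t in Set.Iic 0, osgt m σ t = 1 / 2 := by
  have hQ := (gaussQ_pos (m / σ)).ne'
  rw [integral_Iic_osgt m hσ le_rfl, sub_zero]
  field_simp

lemma integral_Ioi_zero_osgt (m : ℝ) {σ : ℝ} (hσ : 0 < σ) :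
    ∫ t in Set.Ioi 0, osgt m σ t = 1 / 2 := by
  have hQ := (gaussQ_pos (m / σ)).ne'
  rw [integral_Ioi_osgt m hσ le_rfl, add_zero]
  field_simp

lemma integrable_osgt (m : ℝ) {σ : ℝ} (hσ : 0 < σ) : Integrable (osgt m σ) := by
  have hl : IntegrableOn (osgt m σ) (Set.Iic 0) :=
    Integrable.of_integral_ne_zero (by rw [integral_Iic_zero_osgt m hσ]; norm_num)
  have hr : IntegrableOn (osgt m σ) (Set.Ioi 0) :=
    Integrable.of_integral_ne_zero (by rw [integral_Ioi_zero_osgt m hσ]; norm_num)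
  simpa using hl.union hr

lemma integral_osgt (m : ℝ) {σ : ℝ} (hσ : 0 < σ) : ∫ t, osgt m σ t = 1 := by
  have h := integrable_osgt m hσ
  rw [← intervalIntegral.integral_Iic_add_Ioi h.integrableOn (h.integrableOn (s := Set.Ioi 0)),
    integral_Iic_zero_osgt m hσ, integral_Ioi_zero_osgt m hσ]
  norm_num

/-- the CDF of the OSGT density. -/
theorem osgt_cdf (m σ : ℝ) (hm : 0 < m) (hσ : 0 < σ) (y : ℝ) :
    ∫ t in Set.Iic y, osgt m σ t =
      if y ≤ 0 then gaussQ ((m - y) / σ) / (2 * gaussQ (m / σ))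
      else 1 - gaussQ ((m + y) / σ) / (2 * gaussQ (m / σ)) := by
  split_ifs with hy
  · exact integral_Iic_osgt m hσ hy
  · have h := integrable_osgt m hσ
    have hsum := intervalIntegral.integral_Iic_add_Ioi (b := y) h.integrableOn h.integrableOn
    rw [integral_osgt m hσ, integral_Ioi_osgt m hσ (not_le.1 hy).le] at hsum
    linarith
end

section
/- For all m, σ > 0, a random variable Y with the OSGT density with parameters m, σ has mean zero and variance E[Y²] = ∫_{-∞}^{∞} y² f(y) dy = σ² + m² - mσ·exp(-m²/(2σ²))/(√(2π)·Q(m/σ)), and moreover this variance is strictly less than σ². -/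
open MeasureTheory Real Filter Set

theorem setIntegral_Ioi_zero_pos {f : ℝ → ℝ} (hf : IntegrableOn f (Ioi 0))
    (hpos : ∀ x ∈ Ioi (0 : ℝ), 0 < f x) : 0 < ∫ x in Ioi (0 : ℝ), f x := by
  rw [setIntegral_pos_iff_support_of_nonneg_ae
    ((ae_restrict_iff' measurableSet_Ioi).2 (Eventually.of_forall fun x hx => (hpos x hx).le)) hf,
    Set.inter_eq_right.2 fun x hx => Function.mem_support.2 (hpos x hx).ne']
  simp

theorem integrableOn_pow_mul_exp_shifted (m σ : ℝ) (hm : 0 ≤ m) (hσ : 0 < σ) (n : ℕ) :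
    IntegrableOn (fun x : ℝ => x ^ n * Real.exp (-(x + m) ^ 2 / (2 * σ ^ 2))) (Ioi 0) := by
  have hb : 0 < 1 / (2 * σ ^ 2) := by positivity
  have h := integrableOn_rpow_mul_exp_neg_mul_sq hb
    (s := (n : ℝ)) (by linarith [Nat.cast_nonneg (α := ℝ) n])
  refine Integrable.mono' h (by fun_prop) ?_
  refine (ae_restrict_iff' measurableSet_Ioi).2 (Eventually.of_forall fun x hx => ?_)
  have hx0 : 0 < x := hx
  rw [Real.norm_of_nonneg (by positivity), Real.rpow_natCast]
  gcongr
  rw [neg_div, neg_mul, neg_le_neg_iff, div_mul_eq_mul_div, one_mul]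
  gcongr
  linarith

theorem hasDerivAt_exp_shifted (m σ x : ℝ) (hσ : σ ≠ 0) :
    HasDerivAt (fun x : ℝ => Real.exp (-(x + m) ^ 2 / (2 * σ ^ 2)))
      (-((x + m) / σ ^ 2) * Real.exp (-(x + m) ^ 2 / (2 * σ ^ 2))) x := by
  have h := (((((hasDerivAt_id x).add_const m).pow 2).neg).div_const (2 * σ ^ 2)).exp
  convert! h using 1
  simp
  field_simp

/-- First moment over the half line of a Gaussian centred at `-m`. -/
theorem integral_shifted_first_moment (m σ : ℝ) (hm : 0 ≤ m) (hσ : 0 < σ) :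
    (∫ x in Ioi (0 : ℝ), x * Real.exp (-(x + m) ^ 2 / (2 * σ ^ 2))) =
      σ ^ 2 * Real.exp (-m ^ 2 / (2 * σ ^ 2)) -
        m * ∫ x in Ioi (0 : ℝ), Real.exp (-(x + m) ^ 2 / (2 * σ ^ 2)) := by
  have h0 : IntegrableOn (fun x : ℝ => Real.exp (-(x + m) ^ 2 / (2 * σ ^ 2))) (Ioi 0) := by
    simpa using integrableOn_pow_mul_exp_shifted m σ hm hσ 0
  have h1 : IntegrableOn (fun x : ℝ => x * Real.exp (-(x + m) ^ 2 / (2 * σ ^ 2))) (Ioi 0) := by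
    simpa using integrableOn_pow_mul_exp_shifted m σ hm hσ 1
  have hd : ∀ x : ℝ, HasDerivAt (fun x : ℝ => -σ ^ 2 * Real.exp (-(x + m) ^ 2 / (2 * σ ^ 2)))
      (x * Real.exp (-(x + m) ^ 2 / (2 * σ ^ 2)) +
        m * Real.exp (-(x + m) ^ 2 / (2 * σ ^ 2))) x := fun x => by
    convert! (hasDerivAt_exp_shifted m σ x hσ.ne').const_mul (-σ ^ 2) using 1
    field_simp
  have hi := h1.add (h0.const_mul m)
  have key := integral_Ioi_of_hasDerivAt_of_tendsto' (fun x _ => hd x) hi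
    (tendsto_zero_of_hasDerivAt_of_integrableOn_Ioi (a := 0) (fun x _ => hd x) hi
      (h0.const_mul _))
  rw [integral_add h1 (h0.const_mul m), integral_const_mul] at key
  simp only [zero_add] at key
  linarith

/-- Second moment over the half line of a Gaussian centred at `-m`. -/
theorem integral_shifted_second_moment (m σ : ℝ) (hm : 0 ≤ m) (hσ : 0 < σ) :
    (∫ x in Ioi (0 : ℝ), x ^ 2 * Real.exp (-(x + m) ^ 2 / (2 * σ ^ 2))) =
      (σ ^ 2 + m ^ 2) * (∫ x in Ioi (0 : ℝ), Real.exp (-(x + m) ^ 2 / (2 * σ ^ 2))) -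
        σ ^ 2 * m * Real.exp (-m ^ 2 / (2 * σ ^ 2)) := by
  have h0 : IntegrableOn (fun x : ℝ => Real.exp (-(x + m) ^ 2 / (2 * σ ^ 2))) (Ioi 0) := by
    simpa using integrableOn_pow_mul_exp_shifted m σ hm hσ 0
  have h1 : IntegrableOn (fun x : ℝ => x * Real.exp (-(x + m) ^ 2 / (2 * σ ^ 2))) (Ioi 0) := by
    simpa using integrableOn_pow_mul_exp_shifted m σ hm hσ 1
  have h2 := integrableOn_pow_mul_exp_shifted m σ hm hσ 2
  have hd : ∀ x : ℝ, HasDerivAt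
      (fun x : ℝ => -σ ^ 2 * ((x - m) * Real.exp (-(x + m) ^ 2 / (2 * σ ^ 2))))
      (x ^ 2 * Real.exp (-(x + m) ^ 2 / (2 * σ ^ 2)) -
        (σ ^ 2 + m ^ 2) * Real.exp (-(x + m) ^ 2 / (2 * σ ^ 2))) x := fun x => by
    convert! (((hasDerivAt_id x).sub_const m).mul
      (hasDerivAt_exp_shifted m σ x hσ.ne')).const_mul (-σ ^ 2) using 1
    simp only [id]
    field_simp
    ring
  have hi := h2.sub (h0.const_mul (σ ^ 2 + m ^ 2))
  have hf : IntegrableOn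
      (fun x : ℝ => -σ ^ 2 * ((x - m) * Real.exp (-(x + m) ^ 2 / (2 * σ ^ 2)))) (Ioi 0) := by
    simp only [sub_mul]
    exact (h1.sub (h0.const_mul m)).const_mul _
  have key := integral_Ioi_of_hasDerivAt_of_tendsto' (fun x _ => hd x) hi
    (tendsto_zero_of_hasDerivAt_of_integrableOn_Ioi (a := 0) (fun x _ => hd x) hi hf)
  rw [integral_sub h2 (h0.const_mul _), integral_const_mul] at key
  simp only [zero_add] at key
  linarith

theorem integral_exp_shifted (m σ : ℝ) (hσ : 0 < σ) :
    (∫ x in Ioi (0 : ℝ), Real.exp (-(x + m) ^ 2 / (2 * σ ^ 2))) =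
      σ * Real.sqrt (2 * Real.pi) * gaussQ (m / σ) := by
  have hshift := (measurePreserving_add_right (volume : Measure ℝ) m).setIntegral_preimage_emb
    (measurableEmbedding_addRight m) (fun x : ℝ => Real.exp (-x ^ 2 / (2 * σ ^ 2))) (Ioi m)
  rw [Set.preimage_add_const_Ioi, sub_self] at hshift
  have hscale := integral_comp_mul_left_Ioi (fun t : ℝ => Real.exp (-t ^ 2 / 2)) m (inv_pos.2 hσ)
  have hs : Real.sqrt (2 * Real.pi) ≠ 0 := by positivity
  have he : ∀ x : ℝ, -(σ⁻¹ * x) ^ 2 / 2 = -x ^ 2 / (2 * σ ^ 2) := fun x => by field_simp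
  simp only [he, inv_inv, smul_eq_mul] at hscale
  rw [hshift, hscale, gaussQ, inv_mul_eq_div]
  field_simp

theorem osgt_abs (m σ y : ℝ) : osgt m σ |y| = osgt m σ y := by
  have hsq : (-y + m) ^ 2 = (y - m) ^ 2 := by ring
  rcases lt_trichotomy y 0 with h | rfl | h
  · rw [abs_of_neg h, osgt, osgt, if_neg (by linarith), if_pos h.le, hsq]
  · simp
  · rw [abs_of_pos h]

/-- mean zero, variance formula, and variance strictly less than `σ²`. -/
theorem osgt_mean_variance (m σ : ℝ) (hm : 0 < m) (hσ : 0 < σ) :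
    (∫ y : ℝ, y * osgt m σ y = 0) ∧
    (∫ y : ℝ, y ^ 2 * osgt m σ y =
      σ ^ 2 + m ^ 2 -
        m * σ * Real.exp (-m ^ 2 / (2 * σ ^ 2)) / (Real.sqrt (2 * Real.pi) * gaussQ (m / σ))) ∧
    σ ^ 2 + m ^ 2 -
        m * σ * Real.exp (-m ^ 2 / (2 * σ ^ 2)) / (Real.sqrt (2 * Real.pi) * gaussQ (m / σ))
      < σ ^ 2 := by
  have hQ := integral_exp_shifted m σ hσ
  have h1 := integral_shifted_first_moment m σ hm.le hσ
  have h2 := integral_shifted_second_moment m σ hm.le hσ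
  have i0 : IntegrableOn (fun x : ℝ => Real.exp (-(x + m) ^ 2 / (2 * σ ^ 2))) (Ioi 0) := by
    simpa using integrableOn_pow_mul_exp_shifted m σ hm.le hσ 0
  have i1 : IntegrableOn (fun x : ℝ => x * Real.exp (-(x + m) ^ 2 / (2 * σ ^ 2))) (Ioi 0) := by
    simpa using integrableOn_pow_mul_exp_shifted m σ hm.le hσ 1
  have p0 : 0 < ∫ x in Ioi (0 : ℝ), Real.exp (-(x + m) ^ 2 / (2 * σ ^ 2)) :=
    setIntegral_Ioi_zero_pos i0 fun x _ => Real.exp_pos _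
  have p1 : 0 < ∫ x in Ioi (0 : ℝ), x * Real.exp (-(x + m) ^ 2 / (2 * σ ^ 2)) :=
    setIntegral_Ioi_zero_pos i1 fun x hx => mul_pos hx (Real.exp_pos _)
  have hs : 0 < Real.sqrt (2 * Real.pi) := by positivity
  have hq : 0 < gaussQ (m / σ) := by
    rw [hQ] at p0
    exact pos_of_mul_pos_right p0 (by positivity)
  refine ⟨?_, ?_, ?_⟩
  · have hodd : ∀ y : ℝ, -y * osgt m σ (-y) = -(y * osgt m σ y) := fun y => by
      rw [← osgt_abs m σ (-y), abs_neg, osgt_abs, neg_mul]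
    have h := integral_neg_eq_self (fun y : ℝ => y * osgt m σ y) volume
    simp only [hodd, integral_neg] at h
    linarith
  · have heven : ∀ y : ℝ, y ^ 2 * osgt m σ y = |y| ^ 2 * osgt m σ |y| := fun y => by
      rw [osgt_abs, sq_abs]
    have hpos : ∀ y ∈ Ioi (0 : ℝ), y ^ 2 * osgt m σ y =
        y ^ 2 * Real.exp (-(y + m) ^ 2 / (2 * σ ^ 2)) /
          (2 * Real.sqrt (2 * Real.pi * σ ^ 2) * gaussQ (m / σ)) := fun y hy => by
      rw [osgt, if_neg (not_le.2 hy), mul_div_assoc]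
    rw [integral_congr_ae (Eventually.of_forall heven),
      integral_comp_abs (f := fun y => y ^ 2 * osgt m σ y),
      setIntegral_congr_fun measurableSet_Ioi hpos, integral_div, h2, hQ,
      Real.sqrt_mul (by positivity : (0 : ℝ) ≤ 2 * Real.pi) (σ ^ 2), Real.sqrt_sq hσ.le]
    field_simp
  · have hlt : m * (σ * Real.sqrt (2 * Real.pi) * gaussQ (m / σ)) <
        σ ^ 2 * Real.exp (-m ^ 2 / (2 * σ ^ 2)) := by
      rw [h1, hQ] at p1
      linarith
    have : m ^ 2 < m * σ * Real.exp (-m ^ 2 / (2 * σ ^ 2)) /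
        (Real.sqrt (2 * Real.pi) * gaussQ (m / σ)) := by
      rw [lt_div_iff₀ (by positivity)]
      have hlt' : m * (Real.sqrt (2 * Real.pi) * gaussQ (m / σ)) <
          σ * Real.exp (-m ^ 2 / (2 * σ ^ 2)) :=
        lt_of_mul_lt_mul_left (by linarith) hσ.le
      nlinarith [mul_lt_mul_of_pos_left hlt' hm]
    linarith
end

section
/- Let m, σ > 0, let V = σ² + m² - mσ·exp(-m²/(2σ²))/(√(2π)·Q(m/σ)) be the variance of the OSGT distribution, and let φ_V(y) = (1/√(2πV))·exp(-y²/(2V)) be the density of the Gaussian distribution with mean zero and the same variance V. Then the ratio f(y)/φ_V(y) tends to +∞ as y → ∞; i.e., the OSGT distribution has a heavier tail than the Gaussian distribution with the same variance. -/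
open MeasureTheory Real Filter Set

lemma integrable_exp_neg_sq_div_two : Integrable fun t : ℝ => exp (-t ^ 2 / 2) := by
  have h := integrable_exp_neg_mul_sq (b := 1 / 2) (by norm_num)
  refine h.congr (.of_forall fun t => ?_)
  simp only
  congr 1
  ring

lemma integrable_mul_exp_neg_sq_div_two : Integrable fun t : ℝ => t * exp (-t ^ 2 / 2) := by
  have h := integrable_mul_exp_neg_mul_sq (b := 1 / 2) (by norm_num)
  refine h.congr (.of_forall fun t => ?_)
  simp only
  congr 2
  ring

lemma integrable_sq_mul_exp_neg_sq_div_two :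
    Integrable fun t : ℝ => t ^ 2 * exp (-t ^ 2 / 2) := by
  have h := integrable_rpow_mul_exp_neg_mul_sq (b := 1 / 2) (by norm_num) (s := 2) (by norm_num)
  refine h.congr (.of_forall fun t => ?_)
  simp only [rpow_two]
  congr 2
  ring

lemma hasDerivAt_exp_neg_sq_div_two (t : ℝ) :
    HasDerivAt (fun t : ℝ => exp (-t ^ 2 / 2)) (-(t * exp (-t ^ 2 / 2))) t := by
  have h := (((hasDerivAt_id t).pow 2).neg.div_const 2).exp
  refine h.congr_deriv ?_
  simp
  ring

lemma setIntegral_Ioi_pos {f : ℝ → ℝ} {a : ℝ} (hf : IntegrableOn f (Ioi a))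
    (hpos : ∀ t ∈ Ioi a, 0 < f t) : 0 < ∫ t in Ioi a, f t := by
  rw [setIntegral_pos_iff_support_of_nonneg_ae
    ((ae_restrict_iff' measurableSet_Ioi).2 (.of_forall fun t ht => (hpos t ht).le)) hf]
  rw [inter_eq_self_of_subset_right (s := Function.support f) fun t ht => (hpos t ht).ne']
  simp

/-- The Mills ratio upper bound for the Gaussian tail. -/
lemma mul_integral_Ioi_lt_exp (a : ℝ) :
    a * ∫ t in Ioi a, exp (-t ^ 2 / 2) < exp (-a ^ 2 / 2) := by
  have h0 := integrable_exp_neg_sq_div_two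
  have h1 := integrable_mul_exp_neg_sq_div_two
  have hlim := tendsto_zero_of_hasDerivAt_of_integrableOn_Ioi (a := a)
    (fun t _ => hasDerivAt_exp_neg_sq_div_two t) h1.neg.integrableOn h0.integrableOn
  have hint := integral_Ioi_of_hasDerivAt_of_tendsto' (a := a)
    (fun t _ => hasDerivAt_exp_neg_sq_div_two t) h1.neg.integrableOn hlim
  have hpos := setIntegral_Ioi_pos (a := a)
    (f := fun t => t * exp (-t ^ 2 / 2) - a * exp (-t ^ 2 / 2))
    (h1.sub (h0.const_mul a)).integrableOn fun t ht => by
      rw [← sub_mul]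
      exact mul_pos (sub_pos.2 ht) (exp_pos _)
  rw [integral_sub h1.integrableOn (h0.const_mul a).integrableOn, integral_const_mul] at hpos
  rw [integral_neg] at hint
  linarith

/-- The second-order Mills ratio bound, from the positivity of the second moment about `a`. -/
lemma mul_exp_lt_mul_integral_Ioi (a : ℝ) :
    a * exp (-a ^ 2 / 2) < (1 + a ^ 2) * ∫ t in Ioi a, exp (-t ^ 2 / 2) := by
  have h0 := integrable_exp_neg_sq_div_two
  have h1 := integrable_mul_exp_neg_sq_div_two
  have h2 := integrable_sq_mul_exp_neg_sq_div_two
  have hF : Integrable fun t : ℝ => (2 * a - t) * exp (-t ^ 2 / 2) :=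
    ((h0.const_mul (2 * a)).sub h1).congr (.of_forall fun t => by simp; ring)
  have hG : Integrable fun t : ℝ => (t - a) ^ 2 * exp (-t ^ 2 / 2) :=
    ((h2.sub (h1.const_mul (2 * a))).add (h0.const_mul (a ^ 2))).congr
      (.of_forall fun t => by simp; ring)
  have hd (t : ℝ) : HasDerivAt (fun t : ℝ => (2 * a - t) * exp (-t ^ 2 / 2))
      ((t - a) ^ 2 * exp (-t ^ 2 / 2) - (1 + a ^ 2) * exp (-t ^ 2 / 2)) t := by
    refine (((hasDerivAt_id t).const_sub (2 * a)).mul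
      (hasDerivAt_exp_neg_sq_div_two t)).congr_deriv ?_
    simp
    ring
  have hF' := (hG.sub (h0.const_mul (1 + a ^ 2))).integrableOn (s := Ioi a)
  have hlim := tendsto_zero_of_hasDerivAt_of_integrableOn_Ioi (fun t _ => hd t) hF'
    hF.integrableOn
  have hint := integral_Ioi_of_hasDerivAt_of_tendsto' (fun t _ => hd t) hF' hlim
  have hpos := setIntegral_Ioi_pos (a := a) hG.integrableOn fun t ht =>
    mul_pos (pow_pos (sub_pos.2 ht) 2) (exp_pos _)
  rw [integral_sub hG.integrableOn (h0.const_mul _).integrableOn, integral_const_mul] at hint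
  linarith

lemma integral_Ioi_exp_neg_sq_div_two_pos (a : ℝ) : 0 < ∫ t in Ioi a, exp (-t ^ 2 / 2) :=
  setIntegral_Ioi_pos integrable_exp_neg_sq_div_two.integrableOn fun _ _ => exp_pos _

lemma sqrt_two_pi_mul_gaussQ (x : ℝ) :
    √(2 * π) * gaussQ x = ∫ t in Ioi x, exp (-t ^ 2 / 2) := by
  have : √(2 * π) ≠ 0 := by positivity
  rw [gaussQ]
  field_simp

/-- The variance of the OSGT distribution lies strictly between `0` and `σ ^ 2`. -/
lemma osgt_variance_mem_Ioo {m σ : ℝ} (hm : 0 < m) (hσ : 0 < σ) :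
    σ ^ 2 + m ^ 2 - m * σ * exp (-m ^ 2 / (2 * σ ^ 2)) / (√(2 * π) * gaussQ (m / σ)) ∈
      Ioo 0 (σ ^ 2) := by
  obtain ⟨a, rfl⟩ : ∃ a, m = a * σ := ⟨m / σ, by field_simp⟩
  have ha : 0 < a := pos_of_mul_pos_left hm hσ.le
  have hexp : -(a * σ) ^ 2 / (2 * σ ^ 2) = -a ^ 2 / 2 := by field_simp
  rw [sqrt_two_pi_mul_gaussQ, mul_div_cancel_right₀ a hσ.ne', hexp]
  have hI := integral_Ioi_exp_neg_sq_div_two_pos a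
  have hu := mul_integral_Ioi_lt_exp a
  have hl := mul_exp_lt_mul_integral_Ioi a
  set I := ∫ t in Ioi a, exp (-t ^ 2 / 2)
  set E := exp (-a ^ 2 / 2)
  have hu' : a < E / I := (lt_div_iff₀ hI).2 hu
  have hl' : a * (E / I) < 1 + a ^ 2 := by
    rw [← mul_div_assoc]
    exact (div_lt_iff₀ hI).2 hl
  have key : σ ^ 2 + (a * σ) ^ 2 - a * σ * σ * E / I
      = σ ^ 2 * (1 + a ^ 2 - a * (E / I)) := by ring
  have hσ2 : 0 < σ ^ 2 := by positivity
  rw [key]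
  constructor
  · exact mul_pos hσ2 (by linarith)
  · exact mul_lt_of_lt_one_right hσ2 (by nlinarith [mul_lt_mul_of_pos_left hu' ha])

/-- the OSGT distribution has a heavier tail than the Gaussian with the same
variance `V`. -/
theorem osgt_heavier_than_gaussian (m σ : ℝ) (hm : 0 < m) (hσ : 0 < σ)
    (V : ℝ)
    (hV : V = σ ^ 2 + m ^ 2 -
      m * σ * Real.exp (-m ^ 2 / (2 * σ ^ 2)) / (Real.sqrt (2 * Real.pi) * gaussQ (m / σ))) :
    Filter.Tendsto
      (fun y : ℝ =>
        osgt m σ y / ((1 / Real.sqrt (2 * Real.pi * V)) * Real.exp (-y ^ 2 / (2 * V))))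
      Filter.atTop Filter.atTop := by
  obtain ⟨hV0, hVσ⟩ : V ∈ Ioo 0 (σ ^ 2) := hV ▸ osgt_variance_mem_Ioo hm hσ
  clear hV
  have hQ := gaussQ_pos (m / σ)
  set S := 2 * √(2 * π * σ ^ 2) * gaussQ (m / σ) with hS
  have hS0 : 0 < S := by positivity
  have hc : 0 < 1 / (2 * V) - 1 / (2 * σ ^ 2) :=
    sub_pos.2 (one_div_lt_one_div_of_lt (by positivity) (by linarith))
  have hexponent : Tendsto (fun y : ℝ =>
      y * ((1 / (2 * V) - 1 / (2 * σ ^ 2)) * y + -(m / σ ^ 2)) + -(m ^ 2 / (2 * σ ^ 2)))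
      atTop atTop :=
    tendsto_atTop_add_const_right _ _ (tendsto_id.atTop_mul_atTop₀
      (tendsto_atTop_add_const_right _ _ (tendsto_id.const_mul_atTop hc)))
  have hC : 0 < √(2 * π * V) / S := by positivity
  refine ((tendsto_exp_atTop.comp hexponent).const_mul_atTop hC).congr' ?_
  filter_upwards [eventually_gt_atTop 0] with y hy
  have hsqrt : √(2 * π * V) ≠ 0 := by positivity
  have harg : y * ((1 / (2 * V) - 1 / (2 * σ ^ 2)) * y + -(m / σ ^ 2)) + -(m ^ 2 / (2 * σ ^ 2))
      = -(y + m) ^ 2 / (2 * σ ^ 2) - -y ^ 2 / (2 * V) := by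
    field_simp
    ring
  rw [Function.comp_apply, harg, exp_sub, osgt, if_neg hy.not_ge, ← hS]
  field_simp
end

section
/- Let m, σ, ε > 0, let q < q' be real numbers with Δ' = q' - q and q̄ = (q + q')/2, and suppose σ²ε/Δ' > Δ'/2 + m. Let y* = q̄ + m - εσ²/Δ'. Then ∫_{-∞}^{y*} (f_q(y) - e^ε·f_{q'}(y)) dy = (1/(2Q(m/σ)))·(Q(εσ/Δ' - Δ'/(2σ)) - e^ε·Q(εσ/Δ' + Δ'/(2σ))). -/
open MeasureTheory Real Filter Set

theorem integrable_exp_neg_sub_sq_div {σ : ℝ} (hσ : 0 < σ) (c : ℝ) :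
    Integrable fun y : ℝ => Real.exp (-(y - c) ^ 2 / (2 * σ ^ 2)) := by
  have h := (integrable_exp_neg_mul_sq (b := 1 / (2 * σ ^ 2)) (by positivity)).comp_sub_right c
  refine h.congr (Eventually.of_forall fun y => ?_)
  dsimp only
  congr 1
  ring

theorem setIntegral_Iic_exp_neg_sub_sq_div {σ : ℝ} (hσ : 0 < σ) (c a : ℝ) :
    ∫ y in Set.Iic a, Real.exp (-(y - c) ^ 2 / (2 * σ ^ 2)) =
      Real.sqrt (2 * Real.pi * σ ^ 2) * gaussQ ((c - a) / σ) := by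
  let G : ℝ → ℝ := (Set.Ioi ((c - a) / σ)).indicator fun t => Real.exp (-t ^ 2 / 2)
  have hG : ∫ y, G ((c - y) / σ) = σ * ∫ t, G t := by
    rw [integral_sub_left_eq_self (fun y => G (y / σ)) volume c, Measure.integral_comp_div,
      abs_of_pos hσ, smul_eq_mul]
  have hset : (fun y => G ((c - y) / σ)) =
      (Set.Iio a).indicator fun y => Real.exp (-(y - c) ^ 2 / (2 * σ ^ 2)) := by
    funext y
    have hmem : (c - y) / σ ∈ Set.Ioi ((c - a) / σ) ↔ y ∈ Set.Iio a := by
      simp only [Set.mem_Ioi, Set.mem_Iio, div_lt_div_iff_of_pos_right hσ, sub_lt_sub_iff_left]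
    simp only [G, Set.indicator_apply, hmem]
    congr 2
    field_simp
    ring
  rw [hset, integral_indicator measurableSet_Iio, integral_indicator measurableSet_Ioi] at hG
  rw [integral_Iic_eq_integral_Iio, hG, gaussQ, Real.sqrt_mul (by positivity),
    Real.sqrt_sq hσ.le]
  have : 0 < Real.sqrt (2 * Real.pi) := by positivity
  field_simp

/-- To the left of its location `q`, the OSGT density is a rescaled Gaussian. -/
theorem osgt_sub_of_le {m σ q y : ℝ} (h : y ≤ q) :
    osgt m σ (y - q) = Real.exp (-(y - (q + m)) ^ 2 / (2 * σ ^ 2)) /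
      (2 * Real.sqrt (2 * Real.pi * σ ^ 2) * gaussQ (m / σ)) := by
  rw [osgt, if_pos (by linarith), sub_sub]

theorem integrableOn_Iic_osgt_sub {m σ q a : ℝ} (hσ : 0 < σ) (h : a ≤ q) :
    IntegrableOn (fun y => osgt m σ (y - q)) (Set.Iic a) :=
  IntegrableOn.congr_fun
    ((integrable_exp_neg_sub_sq_div hσ (q + m)).div_const _).integrableOn
    (fun _ hy => (osgt_sub_of_le (le_trans hy h)).symm) measurableSet_Iic

theorem setIntegral_Iic_osgt_sub {m σ q a : ℝ} (hσ : 0 < σ) (h : a ≤ q) :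
    ∫ y in Set.Iic a, osgt m σ (y - q) =
      1 / (2 * gaussQ (m / σ)) * gaussQ ((q + m - a) / σ) := by
  rw [setIntegral_congr_fun measurableSet_Iic fun y hy => osgt_sub_of_le (le_trans hy h),
    integral_div, setIntegral_Iic_exp_neg_sub_sq_div hσ]
  have : 0 < Real.sqrt (2 * Real.pi * σ ^ 2) := by positivity
  rw [mul_comm 2 (Real.sqrt (2 * Real.pi * σ ^ 2)), mul_assoc (Real.sqrt _),
    mul_div_mul_left _ _ this.ne']
  ring

/-- the value of `δ` in the large-`ε` regime. -/
theorem osgt_delta_large_eps (m σ ε : ℝ) (hm : 0 < m) (hσ : 0 < σ) (hε : 0 < ε)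
    (q q' : ℝ) (hqq : q < q')
    (Δ' qbar : ℝ) (hΔ' : Δ' = q' - q) (hqbar : qbar = (q + q') / 2)
    (hcase : σ ^ 2 * ε / Δ' > Δ' / 2 + m)
    (ystar : ℝ) (hystar : ystar = qbar + m - ε * σ ^ 2 / Δ') :
    ∫ y in Set.Iic ystar, (osgt m σ (y - q) - Real.exp ε * osgt m σ (y - q')) =
      (1 / (2 * gaussQ (m / σ))) *
        (gaussQ (ε * σ / Δ' - Δ' / (2 * σ)) -
          Real.exp ε * gaussQ (ε * σ / Δ' + Δ' / (2 * σ))) := by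
  have hΔ : 0 < Δ' := by linarith
  have hle : ystar ≤ q := by
    rw [mul_comm] at hcase
    linarith
  have hle' : ystar ≤ q' := hle.trans hqq.le
  rw [integral_sub (integrableOn_Iic_osgt_sub hσ hle)
    ((integrableOn_Iic_osgt_sub hσ hle').const_mul _), integral_const_mul,
    setIntegral_Iic_osgt_sub hσ hle, setIntegral_Iic_osgt_sub hσ hle']
  have h₁ : (q + m - ystar) / σ = ε * σ / Δ' - Δ' / (2 * σ) := by
    rw [show q + m - ystar = ε * σ ^ 2 / Δ' - Δ' / 2 by linarith]
    field_simp
  have h₂ : (q' + m - ystar) / σ = ε * σ / Δ' + Δ' / (2 * σ) := by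
    rw [show q' + m - ystar = ε * σ ^ 2 / Δ' + Δ' / 2 by linarith]
    field_simp
  rw [h₁, h₂]
  ring
end

section
/- Let m, σ > 0, α > 1, and Δ' > 0. Then ∫_{m}^{Δ'+m} exp((-α·u² - (1-α)·(u - Δ' - 2m)²)/(2σ²)) du = √(2πσ²) · exp(α(α-1)(Δ' + 2m)²/(2σ²)) · (Φ((αΔ' - m(1-2α))/σ) - Φ(((α-1)Δ' - m(1-2α))/σ)). -/
open MeasureTheory Real Filter Set

theorem stdPhi_sub_stdPhi (a b : ℝ) :
    stdPhi b - stdPhi a = (1 / √(2 * π)) * ∫ t in a..b, exp (-t ^ 2 / 2) := by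
  have hint : Integrable (fun t : ℝ => exp (-t ^ 2 / 2)) := by
    have h := integrable_exp_neg_mul_sq (b := 1 / 2) (by norm_num)
    refine h.congr (.of_forall fun t => ?_)
    ring_nf
  rw [stdPhi, stdPhi, ← mul_sub,
    intervalIntegral.integral_Iic_sub_Iic hint.integrableOn hint.integrableOn]

/-- the integral `I₂` in the Rényi divergence computation. -/
theorem I2_integral (m σ α Δ' : ℝ) (hm : 0 < m) (hσ : 0 < σ) (hα : 1 < α) (hΔ' : 0 < Δ') :
    ∫ u in m..(Δ' + m),
        Real.exp ((-α * u ^ 2 - (1 - α) * (u - Δ' - 2 * m) ^ 2) / (2 * σ ^ 2)) =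
      Real.sqrt (2 * Real.pi * σ ^ 2) *
        Real.exp (α * (α - 1) * (Δ' + 2 * m) ^ 2 / (2 * σ ^ 2)) *
        (stdPhi ((α * Δ' - m * (1 - 2 * α)) / σ) -
          stdPhi (((α - 1) * Δ' - m * (1 - 2 * α)) / σ)) := by
  have hsqrt : √(2 * π * σ ^ 2) = σ * √(2 * π) := by
    rw [sqrt_mul (by positivity), sqrt_sq hσ.le, mul_comm]
  have hexp (u : ℝ) : exp ((-α * u ^ 2 - (1 - α) * (u - Δ' - 2 * m) ^ 2) / (2 * σ ^ 2)) =
      exp (α * (α - 1) * (Δ' + 2 * m) ^ 2 / (2 * σ ^ 2)) *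
        exp (-(u / σ + (α - 1) * (Δ' + 2 * m) / σ) ^ 2 / 2) := by
    rw [← exp_add]
    congr 1
    field_simp
    ring
  have hlower : m / σ + (α - 1) * (Δ' + 2 * m) / σ = ((α - 1) * Δ' - m * (1 - 2 * α)) / σ := by
    ring
  have hupper : (Δ' + m) / σ + (α - 1) * (Δ' + 2 * m) / σ = (α * Δ' - m * (1 - 2 * α)) / σ := by
    ring
  have hpi : √(2 * π) ≠ 0 := by positivity
  simp_rw [hexp]
  rw [intervalIntegral.integral_const_mul,
    intervalIntegral.integral_comp_div_add (fun t => exp (-t ^ 2 / 2)) hσ.ne',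
    hlower, hupper, stdPhi_sub_stdPhi, hsqrt, smul_eq_mul]
  field_simp
end
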